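/- arXiv:2207.01563 — 3 statements merged into one kernel-verified Lean document; each statement's English description precedes it below -/
import Mathlib

section
/- Let p be a prime, F an algebraically closed field of characteristic p, and V, W finite-dimensional F-vector spaces. Let f : V → W be an additive map that is Frobenius-semilinear, i.e. f(c • v) = cᵖ • f(v) for all c ∈ F, v ∈ V, and let g : V → W be an injective F-linear map. Then the set {v ∈ V | f(v) = g(v)} (the kernel of the additive map f − g) is finite. -/
/-- Over an algebraically closed field `F` of characteristic `p`,
a Frobenius-semilinear additive map `f` minus an injective `F`-linear map `g` between
finite-dimensional `F`-vector spaces has finite kernel, i.e. `{v | f v = g v}` is finite. -/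
theorem finite_fixedPoints_of_frobeniusSemilinear_sub_injective_linear
    (p : ℕ) (hp : p.Prime) (F : Type*) [Field F] [IsAlgClosed F] [CharP F p]
    (V W : Type*) [AddCommGroup V] [Module F V] [AddCommGroup W] [Module F W]
    [FiniteDimensional F V] [FiniteDimensional F W]
    (f : V →+ W) (hf : ∀ (c : F) (v : V), f (c • v) = c ^ p • f v)
    (g : V →ₗ[F] W) (hg : Function.Injective g) :
    {v : V | f v = g v}.Finite := by
  classical
  obtain ⟨h, hh⟩ := g.exists_leftInverse_of_injective (LinearMap.ker_eq_bot.mpr hg)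
  have hfix : ∀ v : V, f v = g v → h (f v) = v := by
    intro v hv
    rw [hv]
    exact LinearMap.congr_fun hh v
  obtain ⟨b, hbS, hspan, hli⟩ := exists_linearIndependent F {v : V | f v = g v}
  have : Finite b := hli.finite
  have := Fintype.ofFinite b
  have hT : {c : F | c ^ p = c}.Finite := by
    have hne : (Polynomial.X ^ p - Polynomial.X : Polynomial F) ≠ 0 :=
      FiniteField.X_pow_card_sub_X_ne_zero F hp.one_lt
    refine (Polynomial.finite_setOf_isRoot hne).subset ?_
    intro c hc
    simp only [Set.mem_setOf_eq] at hc
    simp [Polynomial.IsRoot, hc]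
  have hpi : (Set.univ.pi fun _ : b => {c : F | c ^ p = c}).Finite := Set.Finite.pi' (fun _ => hT) |>.subset
    (fun c hc i => hc i (Set.mem_univ i))
  refine (hpi.image (fun c : b → F => ∑ i, c i • (i : V))).subset ?_
  intro v hv
  have hvs : v ∈ Submodule.span F (Set.range ((↑) : b → V)) := by
    rw [Subtype.range_coe, hspan]
    exact Submodule.subset_span hv
  obtain ⟨c, hc⟩ := (Submodule.mem_span_range_iff_exists_fun F).mp hvs
  refine ⟨c, ?_, hc⟩
  have h1 : ∑ i, (c i ^ p) • (i : V) = ∑ i, c i • (i : V) := by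
    have h2 := hfix v hv
    rw [← hc, map_sum, map_sum] at h2
    rw [← h2]
    refine Finset.sum_congr rfl fun i _ => ?_
    rw [hf, map_smul, hfix _ (hbS i.2)]
  intro i _
  have h3 : ∑ i, (c i ^ p - c i) • (i : V) = 0 := by
    simp only [sub_smul, Finset.sum_sub_distrib, h1, sub_self]
  exact sub_eq_zero.mp (Fintype.linearIndependent_iff.mp hli _ h3 i)
end

section
/- Let p be a prime, F an algebraically closed field of characteristic p, and W₂(F) the ring of p-typical Witt vectors of length 2 over F (so p·W₂(F) is killed by p and W₂(F)/(p) ≅ F). Let M₂ and N be W₂(F)-modules and M₁ ⊆ M₂ a submodule such that p•M₁ = 0 and p•m ∈ M₁ for every m ∈ M₂ (i.e. p(M₂/M₁) = 0). Then the kernel of the induced map M₁ ⊗_{W₂(F)} N → M₂ ⊗_{W₂(F)} N equals the submodule of M₁ ⊗_{W₂(F)} N spanned by the simple tensors x ⊗ n with x ∈ p•M₂ (viewed inside M₁) and n ∈ N satisfying p•n = 0. -/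
open TensorProduct

theorem aux_ex {R : Type*} [CommRing R] {X M N : Type*} [AddCommGroup X] [Module R X]
    [AddCommGroup M] [Module R M] [AddCommGroup N] [Module R N] (Φ : X →ₗ[R] M)
    (hΦ : Function.Surjective Φ) (z : X ⊗[R] N) (hz : LinearMap.rTensor N Φ z = 0) :
    ∃ u, LinearMap.rTensor N (LinearMap.ker Φ).subtype u = z :=
  ((rTensor_exact N (LinearMap.exact_subtype_ker_map Φ) hΦ) z).1 hz

theorem aux_core {R : Type*} [CommRing R] (q : R)
    {M N I : Type*} [AddCommGroup M] [Module R M] [AddCommGroup N] [Module R N]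
    (M₁ : Submodule R M) (hM : ∀ m : M, q • m ∈ M₁) (m : I → M)
    (hΦ : Function.Surjective (M₁.subtype.coprod (Finsupp.linearCombination R m)))
    (hker : ∀ z : M₁ × (I →₀ R), M₁.subtype.coprod (Finsupp.linearCombination R m) z = 0 →
      ∃ g : I →₀ R, z.2 = q • g)
    (t : M₁ ⊗[R] N) (ht : LinearMap.rTensor N M₁.subtype t = 0) :
    t ∈ Submodule.span R {t : M₁ ⊗[R] N |
      ∃ (x : M₁) (n : N) (m : M), (x : M) = q • m ∧ q • n = 0 ∧ t = x ⊗ₜ n} := by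
  classical
  let P : (I →₀ R) →ₗ[R] M := Finsupp.linearCombination R m
  let Φ : (M₁ × (I →₀ R)) →ₗ[R] M := M₁.subtype.coprod P
  let A : (I →₀ N) →ₗ[R] M₁ ⊗[R] N :=
    Finsupp.lsum R (fun i => TensorProduct.mk R M₁ N ⟨q • m i, hM _⟩)
  let L : (I →₀ N) →ₗ[R] (M₁ ⊗[R] N) × (I →₀ N) := (-A).prod (q • LinearMap.id)
  let Ψ : (M₁ × (I →₀ R)) ⊗[R] N →ₗ[R] (M₁ ⊗[R] N) × (I →₀ N) :=
    (LinearMap.rTensor N (LinearMap.fst R M₁ (I →₀ R))).prod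
      ((TensorProduct.finsuppScalarLeft R N I).toLinearMap ∘ₗ
        LinearMap.rTensor N (LinearMap.snd R M₁ (I →₀ R)))
  have h0 : LinearMap.rTensor N Φ (LinearMap.rTensor N (LinearMap.inl R M₁ (I →₀ R)) t) = 0 := by
    rw [← LinearMap.comp_apply, ← LinearMap.rTensor_comp, LinearMap.coprod_inl, ht]
  obtain ⟨u, hu⟩ := aux_ex Φ hΦ _ h0
  have hΨ1 : Ψ (LinearMap.rTensor N (LinearMap.inl R M₁ (I →₀ R)) t) = (t, 0) := by
    simp only [Ψ, LinearMap.prod_apply, Function.prod, LinearMap.comp_apply]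
    rw [← LinearMap.comp_apply, ← LinearMap.rTensor_comp, ← LinearMap.comp_apply
      (LinearMap.rTensor N (LinearMap.snd R M₁ (I →₀ R))), ← LinearMap.rTensor_comp]
    simp
  have hΨ2 : ∀ u, Ψ (LinearMap.rTensor N (LinearMap.ker Φ).subtype u) ∈ LinearMap.range L := by
    intro u
    induction u with
    | zero => simp
    | add x y hx hy => rw [map_add, map_add]; exact add_mem hx hy
    | tmul z n =>
      obtain ⟨⟨x, f⟩, hz⟩ := z
      obtain ⟨g, rfl : f = q • g⟩ := hker _ hz
      refine ⟨g.mapRange (fun r => r • n) (zero_smul _ _), ?_⟩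
      have hx : x = - g.sum (fun i r => r • (⟨q • m i, hM _⟩ : M₁)) := by
        apply Subtype.ext
        have : (x : M) + q • P g = 0 := by simpa [Φ] using hz
        rw [eq_neg_of_add_eq_zero_left this]
        simp [P, Finsupp.linearCombination_apply, Finsupp.sum, Finset.smul_sum, smul_comm q]
      refine Prod.ext ?_ ?_
      · simp only [L, Ψ, A, LinearMap.prod_apply, Function.prod, LinearMap.neg_apply,
          Finsupp.lsum_apply, LinearMap.rTensor_tmul, Submodule.subtype_apply,
          LinearMap.fst_apply]
        rw [Finsupp.sum_mapRange_index (by simp), hx, TensorProduct.neg_tmul, Finsupp.sum,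
          Finsupp.sum, TensorProduct.sum_tmul]
        simp only [TensorProduct.smul_tmul, TensorProduct.mk_apply]
      · ext i
        simp [L, Ψ, TensorProduct.finsuppScalarLeft_apply_tmul_apply, mul_smul]
  obtain ⟨v, hv⟩ := hΨ2 u
  rw [hu, hΨ1] at hv
  have hv1 : -(A v) = t := congrArg Prod.fst hv
  have hv2 : q • v = 0 := congrArg Prod.snd hv
  rw [← hv1]
  refine neg_mem ?_
  simp only [A, Finsupp.lsum_apply, Finsupp.sum]
  refine Submodule.sum_mem _ fun i _ => Submodule.subset_span ?_
  exact ⟨_, v i, m i, rfl, by simpa using DFunLike.congr_fun hv2 i, rfl⟩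

set_option maxHeartbeats 2000000 in
theorem aux_ker {R : Type*} [CommRing R] (q : R) (hq : (Ideal.span {q}).IsMaximal)
    {M N : Type*} [AddCommGroup M] [Module R M] [AddCommGroup N] [Module R N]
    (M₁ : Submodule R M) (hM₁ : ∀ x ∈ M₁, q • x = 0) (hM : ∀ m : M, q • m ∈ M₁)
    (t : M₁ ⊗[R] N) (ht : LinearMap.rTensor N M₁.subtype t = 0) :
    t ∈ Submodule.span R {t : M₁ ⊗[R] N |
      ∃ (x : M₁) (n : N) (m : M), (x : M) = q • m ∧ q • n = 0 ∧ t = x ⊗ₜ n} := by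
  classical
  let _ : Field (R ⧸ Ideal.span {q}) := Ideal.Quotient.field _
  have htor : Module.IsTorsionBySet R (M ⧸ M₁) (Ideal.span {q} : Ideal R) := by
    rw [← Module.isTorsionBySet_iff_is_torsion_by_span, Module.isTorsionBySet_singleton_iff]
    intro x
    obtain ⟨m, rfl⟩ := M₁.mkQ_surjective x
    rw [← map_smul]
    exact (Submodule.Quotient.mk_eq_zero _).2 (hM m)
  let _ : Module (R ⧸ Ideal.span {q}) (M ⧸ M₁) := htor.module
  have hsm : ∀ (r : R) (x : M ⧸ M₁), (Ideal.Quotient.mk (Ideal.span {q}) r) • x = r • x :=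
    fun r x => rfl
  let b := Module.Basis.ofVectorSpace (R ⧸ Ideal.span {q}) (M ⧸ M₁)
  let I := Module.Basis.ofVectorSpaceIndex (R ⧸ Ideal.span {q}) (M ⧸ M₁)
  choose m hm using fun i : I => M₁.mkQ_surjective (b i)
  let P : (I →₀ R) →ₗ[R] M := Finsupp.linearCombination R m
  let Φ : (M₁ × (I →₀ R)) →ₗ[R] M := M₁.subtype.coprod P
  have hPmk : ∀ f : I →₀ R, M₁.mkQ (P f) = 
      b.repr.symm (f.mapRange (Ideal.Quotient.mk (Ideal.span {q})) (map_zero _)) := by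
    intro f
    rw [Module.Basis.repr_symm_apply, Finsupp.linearCombination_apply (R ⧸ Ideal.span {q}),
      Finsupp.sum_mapRange_index (by simp)]
    simp only [P, Finsupp.linearCombination_apply, Finsupp.sum, map_sum, map_smul, hm, hsm]
    rfl
  have hΦ : Function.Surjective Φ := by
    intro x
    obtain ⟨f, hf⟩ := Finsupp.mapRange_surjective (α := I)
      (Ideal.Quotient.mk (Ideal.span {q})) (map_zero _) Ideal.Quotient.mk_surjective
      (b.repr (M₁.mkQ x))
    have h1 : M₁.mkQ (P f) = M₁.mkQ x := by
      rw [hPmk, hf, LinearEquiv.symm_apply_apply]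
    have h2 : x - P f ∈ M₁ := by
      rw [← Submodule.Quotient.mk_eq_zero, ← Submodule.mkQ_apply, map_sub, h1, sub_self]
    exact ⟨(⟨_, h2⟩, f), by simp [Φ]⟩
  have hker : ∀ z : M₁ × (I →₀ R), Φ z = 0 → ∃ g : I →₀ R, z.2 = q • g := by
    rintro ⟨x, f⟩ hz
    have h1 : M₁.mkQ (P f) = 0 := by
      have : P f = - (x : M) := by
        rw [eq_neg_iff_add_eq_zero, add_comm]; simpa [Φ] using hz
      rw [this, map_neg, neg_eq_zero]
      simp
    rw [hPmk, LinearEquiv.map_eq_zero_iff] at h1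
    have h2 : ∀ i, ∃ a, f i = q * a := by
      intro i
      have := DFunLike.congr_fun h1 i
      rw [Finsupp.mapRange_apply, Finsupp.zero_apply, Ideal.Quotient.eq_zero_iff_mem,
        Ideal.mem_span_singleton'] at this
      obtain ⟨a, ha⟩ := this
      exact ⟨a, by rw [← ha, mul_comm]⟩
    choose a ha using h2
    refine ⟨Finsupp.onFinset f.support (fun i => if i ∈ f.support then a i else 0) ?_, ?_⟩
    · intro i hi
      by_contra h
      simp [h] at hi
    · ext i
      by_cases h : f i = 0
      · simp [h]
      · simp [h, ← ha]
  exact aux_core q M₁ hM m hΦ hker t ht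

theorem aux_max (p : ℕ) [Fact p.Prime] (F : Type*) [Field F] [IsAlgClosed F] [CharP F p] :
    (Ideal.span {(p : TruncatedWittVector p 2 F)}).IsMaximal := by
  have h1 : (Ideal.span {(p : WittVector p F)}).IsMaximal :=
    PrincipalIdealRing.isMaximal_of_irreducible (WittVector.irreducible p)
  have h2 : Ideal.map (WittVector.truncate (p := p) (R := F) 2) (Ideal.span {(p : WittVector p F)})
      = Ideal.span {(p : TruncatedWittVector p 2 F)} := by
    rw [Ideal.map_span, Set.image_singleton, map_natCast]
  rw [← h2]
  refine (Ideal.map_eq_top_or_isMaximal_of_surjective _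
    (WittVector.truncate_surjective p 2 F) h1).resolve_left ?_
  rw [h2, Ideal.eq_top_iff_one, Ideal.mem_span_singleton']
  rintro ⟨a, ha⟩
  obtain ⟨b, rfl⟩ := WittVector.truncate_surjective p 2 F a
  have h3 : WittVector.truncate 2 (b * (p : WittVector p F)) = WittVector.truncate 2 1 := by
    rw [map_mul, map_natCast, ha, map_one]
  have h4 := congrArg (TruncatedWittVector.coeff 0) h3
  rw [WittVector.coeff_truncate, WittVector.coeff_truncate] at h4
  have h5 : WittVector.constantCoeff (b * (p : WittVector p F)) =
    WittVector.constantCoeff (1 : WittVector p F) := h4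
  rw [map_mul, map_natCast, CharP.cast_eq_zero, mul_zero, map_one] at h5
  exact zero_ne_one h5



/-- Let `W₂(F)` be length-2 `p`-typical Witt vectors over an
algebraically closed field `F` of characteristic `p`.  If `M₁ ⊆ M₂` are `W₂(F)`-modules
with `p M₁ = 0` and `p M₂ ⊆ M₁` (i.e. `p (M₂/M₁) = 0`), and `N` is any `W₂(F)`-module,
then the kernel of `M₁ ⊗ N → M₂ ⊗ N` is spanned by the simple tensors `x ⊗ n` with
`x ∈ p M₂` and `p n = 0`. -/
theorem ker_rTensor_eq_span_of_witt
    (p : ℕ) [Fact p.Prime] (F : Type*) [Field F] [IsAlgClosed F] [CharP F p]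
    (M₂ N : Type*) [AddCommGroup M₂] [Module (TruncatedWittVector p 2 F) M₂]
    [AddCommGroup N] [Module (TruncatedWittVector p 2 F) N]
    (M₁ : Submodule (TruncatedWittVector p 2 F) M₂)
    (hM₁ : ∀ x : M₁, p • x = 0)
    (hM₂ : ∀ m : M₂, p • m ∈ M₁) :
    LinearMap.ker (LinearMap.rTensor N M₁.subtype) =
      Submodule.span (TruncatedWittVector p 2 F)
        {t : M₁ ⊗[TruncatedWittVector p 2 F] N |
          ∃ (x : M₁) (n : N) (m : M₂), (x : M₂) = p • m ∧ p • n = 0 ∧ t = x ⊗ₜ n} := by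
  apply le_antisymm
  · intro t ht
    have := aux_ker (p : TruncatedWittVector p 2 F) (aux_max p F) (N := N) M₁
      (fun x hx => by
        rw [Nat.cast_smul_eq_nsmul]
        exact congrArg Subtype.val (hM₁ ⟨x, hx⟩))
      (fun m => by rw [Nat.cast_smul_eq_nsmul]; exact hM₂ m) t ht
    simpa only [Nat.cast_smul_eq_nsmul] using this
  · rw [Submodule.span_le]
    rintro _ ⟨x, n, m, hx, hn, rfl⟩
    rw [SetLike.mem_coe, LinearMap.mem_ker, LinearMap.rTensor_tmul, Submodule.subtype_apply, hx,
      ← Nat.cast_smul_eq_nsmul (TruncatedWittVector p 2 F), TensorProduct.smul_tmul,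
      Nat.cast_smul_eq_nsmul, hn, TensorProduct.tmul_zero]
end

section
/- Let p be a prime and F a field of characteristic p. Let F[ε] = F[x]/(x²) be the dual numbers, ι : F → F[ε] the inclusion and π : F[ε] → F the projection ε ↦ 0, and let W₂ denote length-2 p-typical Witt vectors. Let K ⊆ W₂(F[ε]) be the set of Witt vectors both of whose coefficients lie in εF. Then: (i) K is an ideal of W₂(F[ε]) with K·K = 0; (ii) every u ∈ W₂(F[ε]) can be written uniquely as u = W₂(ι)(w) + z with w ∈ W₂(F) and z ∈ K, namely w = W₂(π)(u); (iii) the map F × F → K sending (x, y) to the Witt vector with coefficients (xε, yε) is an isomorphism of additive groups, and for every w ∈ W₂(F) with 0-th coefficient w₀ one has W₂(ι)(w) · (xε, yε) = (w₀xε, w₀ᵖyε) in W₂(F[ε]). In particular W₂(F[ε]) ≅ W₂(F) ⊕ F(ε,0) ⊕ F(0,ε) as W₂(F)-modules, where W₂(F) acts on the first F-summand through w ↦ w₀ and on the second through w ↦ w₀ᵖ. -/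
open TrivSqZeroExt

/-- The coefficientwise (functorial) map on length-2 `p`-typical Witt vectors induced by
a ring homomorphism `f : R →+* S`. -/
noncomputable def W₂map (p : ℕ) [Fact p.Prime] {R S : Type*} [CommRing R] [CommRing S]
    (f : R →+* S) (x : TruncatedWittVector p 2 R) : TruncatedWittVector p 2 S :=
  TruncatedWittVector.mk p fun i => f (x.coeff i)

section helpers
open MvPolynomial WittVector

theorem aux_wittAdd_one (p : ℕ) [hp : Fact p.Prime] :
    ∃ r, wittAdd p 1 = X (0, 1) + X (1, 1) - X (0, 0) * X (1, 0) * r := by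
  obtain ⟨r, hr⟩ := exists_add_pow_prime_eq hp.out
    (X (0, 0) : MvPolynomial (Fin 2 × ℕ) ℤ) (X (1, 0))
  refine ⟨r, ?_⟩
  have h := wittStructureInt_prop p (X 0 + X 1 : MvPolynomial (Fin 2) ℤ) 1
  have h0 := wittAdd_zero p
  unfold wittAdd at h0 ⊢
  simp only [wittPolynomial_one, map_add, map_mul, map_pow, bind₁_X_right, rename_X, h0,
    bind₁_C_right, rename_C] at h
  have hp0 : (C (p : ℤ) : MvPolynomial (Fin 2 × ℕ) ℤ) ≠ 0 := by
    rw [Ne, C_eq_zero]; exact_mod_cast hp.out.ne_zero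
  have hc : (C (p : ℤ) : MvPolynomial (Fin 2 × ℕ) ℤ) = (p : MvPolynomial (Fin 2 × ℕ) ℤ) := by
    simp
  apply mul_left_cancel₀ hp0
  rw [← hc] at hr
  linear_combination h - hr

theorem aux_wittMul_one (p : ℕ) [hp : Fact p.Prime] :
    wittMul p 1 = X (0, 1) * X (1, 0) ^ p + X (0, 0) ^ p * X (1, 1)
      + C (p : ℤ) * (X (0, 1) * X (1, 1)) := by
  have h := wittStructureInt_prop p (X 0 * X 1 : MvPolynomial (Fin 2) ℤ) 1
  have h0 := wittMul_zero p
  unfold wittMul at h0 ⊢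
  simp only [wittPolynomial_one, map_add, map_mul, map_pow, bind₁_X_right, rename_X, h0,
    bind₁_C_right, rename_C] at h
  have hp0 : (C (p : ℤ) : MvPolynomial (Fin 2 × ℕ) ℤ) ≠ 0 := by
    rw [Ne, C_eq_zero]; exact_mod_cast hp.out.ne_zero
  apply mul_left_cancel₀ hp0
  linear_combination h

variable {p : ℕ} [hp : Fact p.Prime] {R S : Type*} [CommRing R] [CommRing S]

theorem aux_add0 (x y : TruncatedWittVector p 2 R) :
    (x + y).coeff 0 = x.coeff 0 + y.coeff 0 := by
  obtain ⟨x, rfl⟩ := truncate_surjective p 2 R x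
  obtain ⟨y, rfl⟩ := truncate_surjective p 2 R y
  rw [← map_add]
  simp only [coeff_truncate]
  exact add_coeff_zero x y

theorem aux_mul0 (x y : TruncatedWittVector p 2 R) :
    (x * y).coeff 0 = x.coeff 0 * y.coeff 0 := by
  obtain ⟨x, rfl⟩ := truncate_surjective p 2 R x
  obtain ⟨y, rfl⟩ := truncate_surjective p 2 R y
  rw [← map_mul]
  simp only [coeff_truncate]
  exact mul_coeff_zero x y

theorem aux_add1 (x y : TruncatedWittVector p 2 R) :
    ∃ r, (x + y).coeff 1 = x.coeff 1 + y.coeff 1 - x.coeff 0 * y.coeff 0 * r := by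
  obtain ⟨x, rfl⟩ := truncate_surjective p 2 R x
  obtain ⟨y, rfl⟩ := truncate_surjective p 2 R y
  obtain ⟨r, hr⟩ := aux_wittAdd_one p
  refine ⟨peval r ![x.coeff, y.coeff], ?_⟩
  rw [← map_add]
  simp only [coeff_truncate]
  change (x + y).coeff 1 = x.coeff 1 + y.coeff 1 - x.coeff 0 * y.coeff 0 * _
  rw [add_coeff, hr]
  simp [peval, Function.uncurry]

theorem aux_mul1 (x y : TruncatedWittVector p 2 R) :
    (x * y).coeff 1 = x.coeff 1 * y.coeff 0 ^ p + x.coeff 0 ^ p * y.coeff 1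
      + p * (x.coeff 1 * y.coeff 1) := by
  obtain ⟨x, rfl⟩ := truncate_surjective p 2 R x
  obtain ⟨y, rfl⟩ := truncate_surjective p 2 R y
  rw [← map_mul]
  simp only [coeff_truncate]
  change (x * y).coeff 1 = x.coeff 1 * y.coeff 0 ^ p + x.coeff 0 ^ p * y.coeff 1
      + p * (x.coeff 1 * y.coeff 1)
  rw [mul_coeff, aux_wittMul_one]
  simp [peval, Function.uncurry]

theorem aux_W₂map (f : R →+* S) (x : WittVector p R) :
    W₂map p f (truncate 2 x) = truncate 2 (WittVector.map f x) := by
  ext i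
  simp [W₂map, WittVector.map_coeff]

theorem aux_W₂hom (f : R →+* S) :
    ∃ g : TruncatedWittVector p 2 R →+* TruncatedWittVector p 2 S, ∀ x, W₂map p f x = g x := by
  have surj := truncate_surjective p 2 R
  refine ⟨{ toFun := W₂map p f, map_zero' := ?_, map_one' := ?_, map_add' := ?_,
            map_mul' := ?_ }, fun x => rfl⟩
  · rw [← map_one (truncate 2), aux_W₂map, map_one, map_one]
  · intro x y
    obtain ⟨x, rfl⟩ := surj x
    obtain ⟨y, rfl⟩ := surj y
    simp only [← map_mul, aux_W₂map]
  · rw [← map_zero (truncate 2), aux_W₂map, map_zero, map_zero]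
  · intro x y
    obtain ⟨x, rfl⟩ := surj x
    obtain ⟨y, rfl⟩ := surj y
    simp only [← map_add, aux_W₂map]

end helpers

/-- Decomposition `W₂(F[ε]) ≅ W₂(F) ⊕ F(ε,0) ⊕ F(0,ε)` of the length-2
`p`-typical Witt vectors of the dual numbers, where `K` is the square-zero ideal of Witt
vectors all of whose coefficients are multiples of `ε`:
(i) `K` is an ideal with `K·K = 0`; (ii) every `u` is uniquely `W₂(ι)(w) + z` with
`w = W₂(π)(u)` and `z ∈ K`; (iii) `(x, y) ↦ (xε, yε)` is an additive isomorphism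
`F × F ≅ K`, and `W₂(ι)(w) · (xε, yε) = (w₀·x·ε, w₀ᵖ·y·ε)`. -/
theorem wittVector_dualNumber_decomposition
    (p : ℕ) [Fact p.Prime] (F : Type*) [Field F] [CharP F p]
    (K : Set (TruncatedWittVector p 2 (DualNumber F)))
    (hK : K = {u | ∀ i, (u.coeff i).fst = 0})
    (e : F × F → TruncatedWittVector p 2 (DualNumber F))
    (he : e = fun xy => TruncatedWittVector.mk p ![inr xy.1, inr xy.2]) :
    -- (i) `K` is an ideal with `K·K = 0`
    ((0 : TruncatedWittVector p 2 (DualNumber F)) ∈ K ∧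
      (∀ u ∈ K, ∀ v ∈ K, u + v ∈ K) ∧
      (∀ u ∈ K, -u ∈ K) ∧
      (∀ r : TruncatedWittVector p 2 (DualNumber F), ∀ u ∈ K, r * u ∈ K) ∧
      (∀ u ∈ K, ∀ v ∈ K, u * v = 0)) ∧
    -- (ii) unique decomposition `u = W₂(ι)(w) + z`, `z ∈ K`, with `w = W₂(π)(u)`
    ((∀ u : TruncatedWittVector p 2 (DualNumber F),
        u - W₂map p (inlHom F F) (W₂map p (fstHom F F F).toRingHom u) ∈ K) ∧
      (∀ (u : TruncatedWittVector p 2 (DualNumber F))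
         (w : TruncatedWittVector p 2 F) (z : TruncatedWittVector p 2 (DualNumber F)),
        z ∈ K → u = W₂map p (inlHom F F) w + z →
          w = W₂map p (fstHom F F F).toRingHom u ∧
            z = u - W₂map p (inlHom F F) (W₂map p (fstHom F F F).toRingHom u))) ∧
    -- (iii) `e : F × F ≅ K` additively, and the `W₂(F)`-module structure on `K`
    (Function.Injective e ∧ Set.range e = K ∧
      (∀ a b : F × F, e (a + b) = e a + e b) ∧
      (∀ (w : TruncatedWittVector p 2 F) (x y : F),
        W₂map p (inlHom F F) w * e (x, y) =
          e (w.coeff 0 * x, (w.coeff 0) ^ p * y))) := by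
  have hp : p.Prime := Fact.out
  obtain ⟨g, hg⟩ := aux_W₂hom (p := p) (fstHom F F F).toRingHom
  obtain ⟨j, hj⟩ := aux_W₂hom (p := p) (inlHom F F)
  have hgj : ∀ w, g (j w) = w := by
    intro w
    rw [← hj, ← hg]
    ext i
    simp [W₂map]
  have hKg : ∀ u, u ∈ K ↔ g u = 0 := by
    intro u
    rw [hK, ← hg, TruncatedWittVector.ext_iff]
    simp [W₂map]
  have hinr : ∀ u ∈ K, ∀ i, ∃ a : F, u.coeff i = inr a := by
    intro u hu i
    rw [hK] at hu
    refine ⟨(u.coeff i).snd, ?_⟩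
    ext
    · simpa using hu i
    · simp
  have hpow : ∀ a : F, (inr a : DualNumber F) ^ p = 0 := by
    intro a
    obtain ⟨k, hk⟩ := Nat.exists_eq_add_of_le hp.two_le
    rw [hk, pow_add, pow_two, inr_mul_inr, zero_mul]
  have hp0 : ((p : ℕ) : DualNumber F) = 0 := by
    have : ((p : ℕ) : DualNumber F) = inlHom F F ((p : ℕ) : F) :=
      (map_natCast (inlHom F F) p).symm
    rw [this, CharP.cast_eq_zero, map_zero]
  simp only [hg, hj]
  refine ⟨⟨?_, ?_, ?_, ?_, ?_⟩, ⟨?_, ?_⟩, ?_, ?_, ?_, ?_⟩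
  · simp [hKg]
  · intro u hu v hv
    rw [hKg] at *
    simp [hu, hv]
  · intro u hu
    rw [hKg] at *
    simp [hu]
  · intro r u hu
    rw [hKg] at *
    simp [hu]
  · intro u hu v hv
    obtain ⟨a, ha⟩ := hinr u hu 0
    obtain ⟨b, hb⟩ := hinr u hu 1
    obtain ⟨c, hc⟩ := hinr v hv 0
    obtain ⟨d, hd⟩ := hinr v hv 1
    ext1 i
    rw [TruncatedWittVector.coeff_zero]
    fin_cases i
    · change (u * v).coeff 0 = 0
      rw [aux_mul0, ha, hc, inr_mul_inr]
    · change (u * v).coeff 1 = 0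
      rw [aux_mul1, ha, hb, hc, hd, hpow, hpow, inr_mul_inr]
      simp
  · intro u
    rw [hKg, map_sub, hgj, sub_self]
  · intro u w z hz hu
    rw [hKg] at hz
    have : g u = w := by rw [hu, map_add, hgj, hz, add_zero]
    rw [this]
    exact ⟨rfl, by rw [hu]; abel⟩
  · rintro ⟨a, b⟩ ⟨c, d⟩ h
    rw [he, TruncatedWittVector.ext_iff] at h
    have h0 := h 0
    have h1 := h 1
    simp only [TruncatedWittVector.coeff_mk] at h0 h1
    exact Prod.ext (inr_injective h0) (inr_injective h1)
  · ext u
    constructor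
    · rintro ⟨⟨a, b⟩, rfl⟩
      rw [hK, he]
      intro i
      fin_cases i <;> simp
    · intro hu
      obtain ⟨a, ha⟩ := hinr u hu 0
      obtain ⟨b, hb⟩ := hinr u hu 1
      refine ⟨(a, b), ?_⟩
      rw [he]
      ext1 i
      fin_cases i
      · exact ha.symm
      · exact hb.symm
  · rintro ⟨a, b⟩ ⟨c, d⟩
    have e0 : ∀ x : F × F, (e x).coeff 0 = inr x.1 := by intro x; rw [he]; rfl
    have e1 : ∀ x : F × F, (e x).coeff 1 = inr x.2 := by intro x; rw [he]; rfl
    ext1 i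
    fin_cases i
    · change (e _).coeff 0 = (_ + _ : TruncatedWittVector p 2 (DualNumber F)).coeff 0
      rw [aux_add0, e0, e0, e0, ← inr_add]; rfl
    · change (e _).coeff 1 = (_ + _ : TruncatedWittVector p 2 (DualNumber F)).coeff 1
      obtain ⟨r, hr⟩ := aux_add1 (e (a, b)) (e (c, d))
      rw [hr, e0, e0, e1, e1, e1, inr_mul_inr, zero_mul, sub_zero, ← inr_add]; rfl
  · intro w x y
    have e0 : ∀ x : F × F, (e x).coeff 0 = inr x.1 := by intro x; rw [he]; rfl
    have e1 : ∀ x : F × F, (e x).coeff 1 = inr x.2 := by intro x; rw [he]; rfl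
    have j0 : (j w).coeff 0 = inl (w.coeff 0) := by rw [← hj]; rfl
    have jp : (inl (w.coeff 0) : DualNumber F) ^ p = inl (w.coeff 0 ^ p) :=
      (map_pow (inlHom F F) _ _).symm
    ext1 i
    fin_cases i
    · change (_ * _ : TruncatedWittVector p 2 (DualNumber F)).coeff 0 = (e _).coeff 0
      rw [aux_mul0, e0, e0, j0, inl_mul_inr]; rfl
    · change (_ * _ : TruncatedWittVector p 2 (DualNumber F)).coeff 1 = (e _).coeff 1
      rw [aux_mul1, e0, e1, e1, j0, hpow, hp0, jp, inl_mul_inr]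
      simp
end
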